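/- The poison group H(F₂) is residually finite. -/

import Mathlib

/-!
STATEMENT 12: The poison group `H(F₂)` is residually finite.
-/
variable (G : Type*) [Group G]

/-- The diagonal subgroup `{(g,g)} ≤ G × G`. -/
def diagSubgroup : Subgroup (G × G) where
  carrier := {p | p.1 = p.2}
  one_mem' := rfl
  mul_mem' := by
    intro a b (ha : a.1 = a.2) (hb : b.1 = b.2)
    show a.1 * b.1 = a.2 * b.2
    rw [ha, hb]
  inv_mem' := by
    intro a (ha : a.1 = a.2)
    show a.1⁻¹ = a.2⁻¹
    rw [ha]

/-- The subgroup `G × {1} ≤ G × G`. -/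
def leftSubgroup : Subgroup (G × G) where
  carrier := {p | p.2 = 1}
  one_mem' := rfl
  mul_mem' := by
    intro a b (ha : a.2 = 1) (hb : b.2 = 1)
    show a.2 * b.2 = 1
    rw [ha, hb, mul_one]
  inv_mem' := by
    intro a (ha : a.2 = 1)
    show a.2⁻¹ = 1
    rw [ha, inv_one]

/-- The isomorphism `(g,g) ↦ (g,1)` from the diagonal onto `G × {1}`. -/
def diagToLeft : diagSubgroup G ≃* leftSubgroup G where
  toFun x := ⟨(x.1.1, 1), rfl⟩
  invFun x := ⟨(x.1.1, x.1.1), rfl⟩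
  left_inv := by
    rintro ⟨⟨a, b⟩, (h : a = b)⟩
    subst h
    rfl
  right_inv := by
    rintro ⟨⟨a, b⟩, (h : b = 1)⟩
    subst h
    rfl
  map_mul' x y := by
    apply Subtype.ext
    show ((x*y).1.1, (1:G)) = (x.1.1 * y.1.1, 1*1)
    rw [mul_one]
    rfl

/-- The Formanek–Procesi group `H(G)`: the HNN extension of `G × G` with stable
letter `t` and the relations `t (g,g) t⁻¹ = (g,1)`. -/
def FPGroup : Type _ := HNNExtension (G × G) (diagSubgroup G) (leftSubgroup G) (diagToLeft G)

instance : Group (FPGroup G) := by delta FPGroup; infer_instance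

/-- The poison group `H(F₂)`. -/
abbrev PoisonGroup : Type := FPGroup (FreeGroup (Fin 2))

/-- A group `L` is residually finite if every nontrivial element is detected by a
homomorphism to some finite group. -/
def IsResiduallyFinite (L : Type*) [Group L] : Prop :=
  ∀ x : L, x ≠ 1 → ∃ (Q : Type) (_ : Group Q) (_ : Finite Q),
    ∃ f : L →* Q, f x ≠ 1

open Equiv

/-- A group generated by `S` is residually finite if partial left translations by `S` on finite
subsets always extend to permutation representations on larger finite subsets. -/
theorem isResiduallyFinite_of_extend_translations {Γ : Type} [Group Γ] (S : Set Γ)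
    (hS : Subgroup.closure S = ⊤)
    (h : ∀ X₀ : Set Γ, X₀.Finite → ∃ X : Set Γ, X.Finite ∧ X₀ ⊆ X ∧ ∃ f : Γ →* Perm X,
      ∀ s ∈ S, ∀ (x : X) (hx : s * x ∈ X), f s x = ⟨s * x, hx⟩) :
    IsResiduallyFinite Γ := by
  have key : ∀ g : Γ, ∀ y : Γ, ∃ X₀ : Set Γ, X₀.Finite ∧ y ∈ X₀ ∧ g * y ∈ X₀ ∧
      ∀ X : Set Γ, X₀ ⊆ X → ∀ f : Γ →* Perm X,
        (∀ s ∈ S, ∀ (x : X) (hx : s * x ∈ X), f s x = ⟨s * x, hx⟩) →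
        ∀ x : X, x.1 = y → (f g x).1 = g * y := by
    intro g
    have hg : g ∈ Subgroup.closure S := hS ▸ Subgroup.mem_top g
    induction hg using Subgroup.closure_induction with
    | mem s hs =>
      intro y
      refine ⟨{y, s * y}, by simp, by simp, by simp, ?_⟩
      rintro X hX f hf x rfl
      rw [hf s hs x (hX (by simp))]
    | one =>
      intro y
      exact ⟨{y}, by simp, by simp, by simp, by simp⟩
    | mul a b _ _ iha ihb =>
      intro y
      obtain ⟨Y, hYfin, hyY, hbY, hY⟩ := ihb y
      obtain ⟨Z, hZfin, hyZ, haZ, hZ⟩ := iha (b * y)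
      refine ⟨Y ∪ Z, hYfin.union hZfin, .inl hyY, .inr (by rwa [mul_assoc]), ?_⟩
      intro X hX f hf x hx
      rw [map_mul, Perm.mul_apply, mul_assoc]
      exact hZ X (Set.subset_union_right.trans hX) f hf _
        (hY X (Set.subset_union_left.trans hX) f hf x hx)
    | inv a _ iha =>
      intro y
      obtain ⟨Y, hYfin, hyY, haY, hY⟩ := iha (a⁻¹ * y)
      rw [mul_inv_cancel_left] at haY
      refine ⟨Y, hYfin, haY, hyY, ?_⟩
      intro X hX f hf x hx
      have h1 := hY X hX f hf ⟨a⁻¹ * y, hX hyY⟩ rfl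
      rw [mul_inv_cancel_left] at h1
      rw [map_inv, Perm.inv_eq_iff_eq.2 (Subtype.ext (hx.trans h1.symm))]
  intro g hg
  obtain ⟨X₀, hX₀, h1, -, hfix⟩ := key g 1
  obtain ⟨X, hX, hsub, f, hf⟩ := h X₀ hX₀
  have := hX.to_subtype
  refine ⟨Perm X, inferInstance, inferInstance, f, fun hfg => hg ?_⟩
  have := hfix X hsub f hf ⟨1, hsub h1⟩ rfl
  simpa [hfg] using this.symm

/-- Free groups are residually finite. -/
theorem FreeGroup.isResiduallyFinite (α : Type) : IsResiduallyFinite (FreeGroup α) := by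
  classical
  refine isResiduallyFinite_of_extend_translations _ (FreeGroup.closure_range_of α) ?_
  intro X hX
  have := hX.fintype
  let e (a : α) : {x : X // FreeGroup.of a * x.1 ∈ X} ≃ {x : X // (FreeGroup.of a)⁻¹ * x.1 ∈ X} :=
    { toFun x := ⟨⟨FreeGroup.of a * x, x.2⟩, by simp⟩
      invFun x := ⟨⟨(FreeGroup.of a)⁻¹ * x, x.2⟩, by simp⟩
      left_inv x := by simp
      right_inv x := by simp }
  refine ⟨X, hX, subset_rfl, FreeGroup.lift fun a => (e a).extendSubtype, ?_⟩
  rintro _ ⟨a, rfl⟩ x hx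
  rw [FreeGroup.lift_apply_of, Equiv.extendSubtype_apply_of_mem (e a) x hx]
  rfl

/-- A free action is equivariantly a product of the acting group with the orbit space. -/
theorem exists_equivariant_equiv_prod_orbits {A E : Type*} [Group A] [MulAction A E]
    (hE : ∀ (a : A) (x : E), a • x = x → a = 1) :
    ∃ e : A × MulAction.orbitRel.Quotient A E ≃ E, ∀ (a b : A) o, e (a * b, o) = a • e (b, o) := by
  refine ⟨Equiv.ofBijective (fun x => x.1 • x.2.out) ⟨?_, ?_⟩, fun a b o => mul_smul _ _ _⟩
  · rintro ⟨a, o⟩ ⟨b, o'⟩ h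
    dsimp only at h
    have ho : o = o' := by
      rw [← Quotient.out_eq o, ← Quotient.out_eq o']
      exact Quotient.sound ⟨a⁻¹ * b, by simp [mul_smul, ← h]⟩
    subst ho
    rw [inv_mul_eq_one.1 (hE (b⁻¹ * a) o.out (by simp [mul_smul, h]))]
  · intro x
    obtain ⟨a, ha⟩ : MulAction.orbitRel A E x (Quotient.mk (MulAction.orbitRel A E) x).out :=
      (MulAction.orbitRel A E).symm (Quotient.mk_out x)
    exact ⟨(a, _), ha⟩

/-- Two finite free actions of a group on sets of equal cardinality are isomorphic. -/
theorem exists_equivariant_equiv {A C D : Type*} [Group A] [Finite A] [MulAction A C]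
    [MulAction A D] [Finite C] [Finite D] (hC : ∀ (a : A) (c : C), a • c = c → a = 1)
    (hD : ∀ (a : A) (d : D), a • d = d → a = 1) (hcard : Nat.card C = Nat.card D) :
    ∃ e : C ≃ D, ∀ (a : A) (c : C), e (a • c) = a • e c := by
  obtain ⟨u, hu⟩ := exists_equivariant_equiv_prod_orbits hC
  obtain ⟨v, hv⟩ := exists_equivariant_equiv_prod_orbits hD
  have hcard' : Nat.card (MulAction.orbitRel.Quotient A C) =
      Nat.card (MulAction.orbitRel.Quotient A D) := by
    rw [← Nat.card_congr u, ← Nat.card_congr v, Nat.card_prod, Nat.card_prod] at hcard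
    exact Nat.eq_of_mul_eq_mul_left Nat.card_pos hcard
  have : Finite (MulAction.orbitRel.Quotient A C) := Quotient.finite _
  have : Finite (MulAction.orbitRel.Quotient A D) := Quotient.finite _
  let w := (Finite.equivFinOfCardEq hcard').trans (Finite.equivFin _).symm
  refine ⟨u.symm.trans (((Equiv.refl A).prodCongr w).trans v), fun a c => ?_⟩
  obtain ⟨⟨b, o⟩, rfl⟩ := u.surjective c
  rw [← hu]
  simp [hv]

/-- A partial bijection of a finite set intertwining two free actions extends to a permutation
intertwining them. -/
theorem exists_perm_extending_equivariant {A X : Type*} [Group A] [Finite A] [Finite X]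
    (ρ σ : A →* Perm X) (hρ : ∀ a x, ρ a x = x → a = 1) (hσ : ∀ a x, σ a x = x → a = 1)
    {p q : X → Prop} (hp : ∀ a x, p x → p (ρ a x)) (hq : ∀ a x, q x → q (σ a x))
    (e : {x // p x} ≃ {x // q x})
    (he : ∀ a x, (e ⟨ρ a x.1, hp a x.1 x.2⟩).1 = σ a (e x).1) :
    ∃ τ : Perm X, (∀ a x, τ (ρ a x) = σ a (τ x)) ∧ ∀ x (h : p x), τ x = e ⟨x, h⟩ := by
  classical
  have hp' : ∀ a x, ¬ p x → ¬ p (ρ a x) := fun a x h h' =>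
    h (by simpa using hp a⁻¹ _ h')
  have hq' : ∀ a x, ¬ q x → ¬ q (σ a x) := fun a x h h' =>
    h (by simpa using hq a⁻¹ _ h')
  let _ : MulAction A {x // ¬ p x} :=
    { smul a x := ⟨ρ a x, hp' a x x.2⟩
      one_smul x := Subtype.ext (by change ρ 1 x.1 = x.1; simp)
      mul_smul a b x := Subtype.ext (by change ρ (a * b) x.1 = ρ a (ρ b x.1); simp) }
  let _ : MulAction A {x // ¬ q x} :=
    { smul a x := ⟨σ a x, hq' a x x.2⟩
      one_smul x := Subtype.ext (by change σ 1 x.1 = x.1; simp)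
      mul_smul a b x := Subtype.ext (by change σ (a * b) x.1 = σ a (σ b x.1); simp) }
  obtain ⟨e', he'⟩ := exists_equivariant_equiv (A := A) (C := {x // ¬ p x}) (D := {x // ¬ q x})
    (fun a c h => hρ a c (congrArg Subtype.val h)) (fun a c h => hσ a c (congrArg Subtype.val h))
    (Nat.card_congr e.toCompl)
  refine ⟨Equiv.subtypeCongr e e', fun a x => ?_, fun x h => ?_⟩
  · by_cases h : p x
    · simpa [Equiv.subtypeCongr, h, hp a x h] using he a ⟨x, h⟩
    · have : (e' ⟨ρ a x, hp' a x h⟩).1 = σ a (e' ⟨x, h⟩).1 := congrArg Subtype.val (he' a ⟨x, h⟩)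
      simpa [Equiv.subtypeCongr, h, hp' a x h] using this
  · simp [Equiv.subtypeCongr, h]

namespace HNNExtension

/-- An HNN extension is generated by the base group and the stable letter. -/
theorem closure_range_of_union_t {K : Type*} [Group K] {A B : Subgroup K} (φ : A ≃* B) :
    Subgroup.closure (Set.range of ∪ {t} : Set (HNNExtension K A B φ)) = ⊤ := by
  refine (Subgroup.eq_top_iff' _).2 fun x => ?_
  induction x using HNNExtension.induction_on with
  | of g => exact Subgroup.subset_closure (.inl ⟨g, rfl⟩)
  | t => exact Subgroup.subset_closure (.inr rfl)
  | mul x y hx hy => exact mul_mem hx hy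
  | inv x hx => exact inv_mem hx

/-- An HNN extension of a finite group is residually finite. -/
theorem isResiduallyFinite_of_finite {K : Type} [Group K] [Finite K] {A B : Subgroup K}
    (φ : A ≃* B) : IsResiduallyFinite (HNNExtension K A B φ) := by
  refine isResiduallyFinite_of_extend_translations _ (closure_range_of_union_t φ) ?_
  intro X₀ hX₀
  let X : Set (HNNExtension K A B φ) := Set.image (fun z => of z.1 * z.2) (Set.univ ×ˢ X₀)
  have hX : X.Finite := (Set.finite_univ.prod hX₀).image _
  have hsub : X₀ ⊆ X := fun x hx => ⟨(1, x), ⟨trivial, hx⟩, by simp⟩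
  have hmul : ∀ (k : K) {x}, x ∈ X → of k * x ∈ X := by
    rintro k _ ⟨⟨l, x⟩, ⟨-, hx⟩, rfl⟩
    exact ⟨(k * l, x), ⟨trivial, hx⟩, by simp [mul_assoc]⟩
  have := hX.to_subtype
  let _ : MulAction K X :=
    { smul k x := ⟨of k * x.1, hmul k x.2⟩
      one_smul x := Subtype.ext (by change of 1 * x.1 = x.1; simp)
      mul_smul k l x := Subtype.ext (by
        change of (k * l) * x.1 = of k * (of l * x.1); simp [mul_assoc]) }
  let r : K →* Perm X := MulAction.toPermHom K X
  have hr : ∀ k x, (r k x).1 = of k * x.1 := fun _ _ => rfl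
  have hfree : ∀ k x, r k x = x → k = 1 := fun k x h => by
    have := congrArg Subtype.val h
    rw [hr, mul_eq_right] at this
    exact of_injective φ (by simpa using this)
  let e : {x : X // t * x.1 ∈ X} ≃ {x : X // t⁻¹ * x.1 ∈ X} :=
    { toFun x := ⟨⟨t * x.1.1, x.2⟩, by simp⟩
      invFun x := ⟨⟨t⁻¹ * x.1.1, x.2⟩, by simp⟩
      left_inv x := by simp
      right_inv x := by simp }
  obtain ⟨τ, hτ, hτe⟩ := exists_perm_extending_equivariant (r.comp A.subtype)
    (r.comp (B.subtype.comp φ.toMonoidHom))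
    (fun a x h => Subtype.ext (hfree a x h))
    (fun a x h => φ.injective (by rw [map_one]; exact Subtype.ext (hfree (φ a) x h)))
    (p := fun x => t * x.1 ∈ X) (q := fun x => t⁻¹ * x.1 ∈ X)
    (fun a x h => by
      change t * (of (a : K) * x.1) ∈ X
      rw [← mul_assoc, t_mul_of, mul_assoc]
      exact hmul _ h)
    (fun a x h => by
      change t⁻¹ * (of (φ a : K) * x.1) ∈ X
      rw [← mul_assoc, inv_t_mul_of, mul_assoc]
      exact hmul _ h) e
    (fun a x => Subtype.ext (by
      change t * (of (a : K) * x.1.1) = of (φ a : K) * (t * x.1.1)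
      rw [← mul_assoc, t_mul_of, mul_assoc]))
  refine ⟨X, hX, hsub, lift r τ fun a => Equiv.ext fun x => hτ a x, ?_⟩
  rintro _ (⟨k, rfl⟩ | rfl) x hx
  · rw [lift_of]
    rfl
  · rw [lift_t, hτe x hx]
    rfl

end HNNExtension

/-- Finitely many elements of a residually finite group are simultaneously detected in one finite
quotient. -/
theorem IsResiduallyFinite.exists_hom_of_finite {L : Type*} [Group L] (hL : IsResiduallyFinite L)
    {T : Set L} (hT : T.Finite) :
    ∃ (Q : Type) (_ : Group Q) (_ : Finite Q) (f : L →* Q), ∀ x ∈ T, f x = 1 → x = 1 := by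
  induction T, hT using Set.Finite.induction_on with
  | empty => exact ⟨Unit, inferInstance, inferInstance, 1, by simp⟩
  | @insert a T _ _ ih =>
    obtain ⟨Q, _, _, f, hf⟩ := ih
    by_cases ha : a = 1
    · refine ⟨Q, inferInstance, inferInstance, f, ?_⟩
      rintro x (rfl | hx) h
      exacts [ha, hf x hx h]
    · obtain ⟨P, _, _, g, hg⟩ := hL a ha
      refine ⟨P × Q, inferInstance, inferInstance, g.prod f, ?_⟩
      rintro x (rfl | hx) h
      · exact absurd (congrArg Prod.fst h) hg
      · exact hf x hx (congrArg Prod.snd h)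

namespace FPGroup

open HNNExtension

/-- The Formanek–Procesi construction is functorial. -/
def map {L Q : Type*} [Group L] [Group Q] (f : L →* Q) :
    HNNExtension (L × L) _ _ (diagToLeft L) →* HNNExtension (Q × Q) _ _ (diagToLeft Q) :=
  lift (of.comp (f.prodMap f)) t (by
    rintro ⟨⟨a, b⟩, h : a = b⟩
    subst h
    change t * of (f a, f a) = of (f a, f 1) * t
    rw [map_one]
    exact t_mul_of (φ := diagToLeft Q) ⟨(f a, f a), rfl⟩)

/-- The Formanek–Procesi group of a residually finite group is residually finite. -/
theorem isResiduallyFinite {L : Type*} [Group L] (hL : IsResiduallyFinite L) :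
    IsResiduallyFinite (FPGroup L) := by
  change IsResiduallyFinite (HNNExtension (L × L) _ _ (diagToLeft L))
  intro x hx
  obtain ⟨d⟩ := NormalWord.TransversalPair.nonempty (L × L) (diagSubgroup L) (leftSubgroup L)
  obtain ⟨w, rfl⟩ : ∃ w : NormalWord.ReducedWord (L × L) (diagSubgroup L) (leftSubgroup L),
      w.prod (diagToLeft L) = x :=
    ⟨_, (NormalWord.equiv (diagToLeft L) d).symm_apply_apply x⟩
  let T : Set (L × L) := {p | p = w.head ∨ p ∈ w.toList.map Prod.snd}
  have hT : T.Finite := (Set.finite_singleton w.head).union (List.finite_toSet _)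
  obtain ⟨Q, _, _, f, hf⟩ := hL.exists_hom_of_finite
    (((hT.image Prod.fst).union (hT.image Prod.snd)).union (hT.image fun p => p.1 * p.2⁻¹))
  have hf₁ : ∀ p ∈ T, f p.1 = 1 → p.1 = 1 := fun p hp => hf _ (.inl (.inl ⟨p, hp, rfl⟩))
  have hf₂ : ∀ p ∈ T, f p.2 = 1 → p.2 = 1 := fun p hp => hf _ (.inl (.inr ⟨p, hp, rfl⟩))
  have hf₃ : ∀ p ∈ T, f p.1 = f p.2 → p.1 = p.2 := fun p hp h =>
    mul_inv_eq_one.1 (hf _ (.inr ⟨p, hp, rfl⟩) (by simp [h]))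
  let w' : NormalWord.ReducedWord (Q × Q) (diagSubgroup Q) (leftSubgroup Q) :=
    { head := f.prodMap f w.head
      toList := w.toList.map (Prod.map id (f.prodMap f))
      chain := by
        rw [List.isChain_map]
        refine w.chain.imp_of_mem_imp fun a b ha _ hab h => hab ?_
        have haT : a.2 ∈ T := .inr (List.mem_map_of_mem ha)
        obtain ⟨u, p⟩ := a
        rcases Int.units_eq_one_or u with rfl | rfl
        · exact hf₃ p haT h
        · exact hf₂ p haT h }
  have hw' : map f (w.prod (diagToLeft L)) = w'.prod (diagToLeft Q) := by
    simp only [map, NormalWord.ReducedWord.prod, w', map_mul, map_list_prod, lift_of, List.map_map,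
      MonoidHom.comp_apply]
    congr 3
    ext p
    simp
  have hne : w'.prod (diagToLeft Q) ≠ 1 := by
    intro h
    have hnil' := ReducedWord.toList_eq_nil_of_mem_of_range _ w' (h ▸ one_mem _)
    have hnil : w.toList = [] := by simpa [w'] using hnil'
    have hhead : f.prodMap f w.head = 1 := by
      refine of_injective (diagToLeft Q) ?_
      simpa [NormalWord.ReducedWord.prod, w', hnil] using h
    have : w.head = 1 := Prod.ext (hf₁ _ (.inl rfl) (congrArg Prod.fst hhead))
      (hf₂ _ (.inl rfl) (congrArg Prod.snd hhead))
    exact hx (by simp [NormalWord.ReducedWord.prod, hnil, this])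
  obtain ⟨P, _, _, g, hg⟩ := isResiduallyFinite_of_finite (diagToLeft Q) _ hne
  exact ⟨P, inferInstance, inferInstance, g.comp (map f), by rwa [MonoidHom.comp_apply, hw']⟩

end FPGroup

/-- The poison group `H(F₂)` is residually finite. -/
theorem poisonGroup_residuallyFinite : IsResiduallyFinite PoisonGroup :=
  FPGroup.isResiduallyFinite (FreeGroup.isResiduallyFinite _)
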